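/- arXiv:1503.02718 — 7 statements merged into one kernel-verified Lean document; each statement's English description precedes it below -/
import Mathlib

section
/- Let m ≥ 2, let r₁,…,rₘ ∈ ℝ³ be such that at least two of them are linearly independent, and let ρ₁,…,ρₘ > 0. Then the matrix W = −Σ_{i=1}^{m} ρᵢ S(rᵢ)² = Σ_{i=1}^{m} ρᵢ(‖rᵢ‖² I₃ − rᵢ rᵢᵀ) is symmetric positive definite. -/
open Matrix

/-- `skew x` is the matrix `S(x)` with `S(x) y = x × y`. -/
def skew (x : Fin 3 → ℝ) : Matrix (Fin 3) (Fin 3) ℝ :=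
  !![0, -x 2, x 1; x 2, 0, -x 0; -x 1, x 0, 0]

theorem skew_quad (a x : Fin 3 → ℝ) :
    x ⬝ᵥ ((skew a * skew a) *ᵥ x) = -((skew a *ᵥ x) ⬝ᵥ (skew a *ᵥ x)) := by
  simp [skew, Matrix.mulVec, dotProduct, Fin.sum_univ_three, Matrix.mul_apply]
  ring

theorem skew_zero_par (a x : Fin 3 → ℝ) (h : skew a *ᵥ x = 0) :
    (x ⬝ᵥ x) • a = (x ⬝ᵥ a) • x := by
  have h0 := congrFun h 0
  have h1 := congrFun h 1
  have h2 := congrFun h 2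
  simp [skew, Matrix.mulVec, dotProduct, Fin.sum_univ_three] at h0 h1 h2
  ext k
  fin_cases k <;> simp [dotProduct, Fin.sum_univ_three]
  · linear_combination x 1 * h2 - x 2 * h1
  · linear_combination x 2 * h0 - x 0 * h2
  · linear_combination x 0 * h1 - x 1 * h0

theorem skew_sq (a : Fin 3 → ℝ) :
    -(skew a * skew a) = (a ⬝ᵥ a) • (1 : Matrix (Fin 3) (Fin 3) ℝ) - vecMulVec a a := by
  ext k l
  fin_cases k <;> fin_cases l <;>
    simp [skew, dotProduct, Fin.sum_univ_three, Matrix.mul_apply, vecMulVec_apply] <;> ring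

/-- if at least two of the `rᵢ` are linearly independent and all
`ρᵢ > 0`, then `W = −∑ ρᵢ S(rᵢ)² = ∑ ρᵢ (‖rᵢ‖² I₃ − rᵢ rᵢᵀ)` is symmetric
positive definite. -/
theorem stmt5 (m : ℕ) (hm : 2 ≤ m) (r : Fin m → Fin 3 → ℝ) (ρ : Fin m → ℝ)
    (hρ : ∀ i, 0 < ρ i)
    (hr : ∃ i j : Fin m, i ≠ j ∧ LinearIndependent ℝ ![r i, r j]) :
    (-(∑ i, ρ i • (skew (r i) * skew (r i)))).PosDef ∧
    -(∑ i, ρ i • (skew (r i) * skew (r i))) =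
      ∑ i, ρ i • ((r i ⬝ᵥ r i) • (1 : Matrix (Fin 3) (Fin 3) ℝ) -
        vecMulVec (r i) (r i)) := by
  have heq : -(∑ i, ρ i • (skew (r i) * skew (r i))) =
      ∑ i, ρ i • ((r i ⬝ᵥ r i) • (1 : Matrix (Fin 3) (Fin 3) ℝ) -
        vecMulVec (r i) (r i)) := by
    rw [← Finset.sum_neg_distrib]
    refine Finset.sum_congr rfl fun i _ => ?_
    rw [← skew_sq, smul_neg]
  refine ⟨?_, heq⟩
  refine Matrix.PosDef.of_dotProduct_mulVec_pos ?_ ?_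
  · rw [heq]
    unfold Matrix.IsHermitian
    rw [Matrix.conjTranspose_sum]
    refine Finset.sum_congr rfl fun i _ => ?_
    ext k l
    simp [vecMulVec_apply, Matrix.one_apply, eq_comm, mul_comm]
  · intro x hx
    have hq : star x ⬝ᵥ (-(∑ i, ρ i • (skew (r i) * skew (r i)))) *ᵥ x =
        ∑ i, ρ i * ((skew (r i) *ᵥ x) ⬝ᵥ (skew (r i) *ᵥ x)) := by
      rw [star_trivial, Matrix.neg_mulVec, Matrix.sum_mulVec, dotProduct_neg, dotProduct_sum,
        ← Finset.sum_neg_distrib]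
      refine Finset.sum_congr rfl fun i _ => ?_
      rw [Matrix.smul_mulVec, dotProduct_smul, skew_quad, smul_eq_mul]
      ring
    rw [hq]
    have hsq : ∀ y : Fin 3 → ℝ, 0 ≤ y ⬝ᵥ y := fun y =>
      Finset.sum_nonneg fun k _ => mul_self_nonneg (y k)
    have hnn : ∀ i ∈ Finset.univ, 0 ≤ ρ i * ((skew (r i) *ᵥ x) ⬝ᵥ (skew (r i) *ᵥ x)) :=
      fun i _ => mul_nonneg (hρ i).le (hsq _)
    refine lt_of_le_of_ne (Finset.sum_nonneg hnn) fun h0 => ?_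
    have hz := (Finset.sum_eq_zero_iff_of_nonneg hnn).1 h0.symm
    have hpar : ∀ i, (x ⬝ᵥ x) • r i = (x ⬝ᵥ r i) • x := fun i => by
      apply skew_zero_par
      rcases mul_eq_zero.1 (hz i (Finset.mem_univ i)) with h | h
      · exact absurd h (hρ i).ne'
      · exact dotProduct_self_eq_zero.1 h
    have hxx : x ⬝ᵥ x ≠ 0 := fun h => hx (dotProduct_self_eq_zero.1 h)
    obtain ⟨i, j, -, hli⟩ := hr
    rw [LinearIndependent.pair_iff] at hli
    have h1 : (x ⬝ᵥ r j) • r i + (-(x ⬝ᵥ r i)) • r j = 0 := by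
      apply (smul_eq_zero_iff_right hxx).1
      rw [smul_add, smul_comm, hpar i, smul_comm (x ⬝ᵥ x), hpar j, smul_smul, smul_smul,
        ← add_smul]
      ring_nf
      simp
    have h2 := neg_eq_zero.1 (hli _ _ h1).2
    have h3 : r i = 0 := by
      have := hpar i
      rw [h2, zero_smul] at this
      exact (smul_eq_zero_iff_right hxx).1 this
    have := (hli 1 0 (by simp [h3])).1
    exact one_ne_zero this
end

section
/- Let m, N ≥ 1, and for i = 1,…,m let Aᵢ ∈ ℝ^{N×N}, Bᵢ ∈ ℝ^{N×3}, and let Pᵢ, Qᵢ ∈ ℝ^{N×N} be symmetric with Qᵢ positive semidefinite and AᵢᵀPᵢ + PᵢAᵢ = −Qᵢ; let Γ ∈ ℝ^{3×3} be symmetric positive definite. Suppose bᵢ : ℝ → ℝ³ are any functions and zᵢ : ℝ → ℝ^{N}, η̃ : ℝ → ℝ³ are differentiable with zᵢ'(t) = Aᵢ zᵢ(t) + Bᵢ S(η̃(t)) bᵢ(t) and η̃'(t) = −Γ Σ_{i=1}^{m} S(bᵢ(t)) Bᵢᵀ Pᵢ zᵢ(t). Then the function V₁(t) = Σ_{i=1}^{m}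 zᵢ(t)ᵀ Pᵢ zᵢ(t) + η̃(t)ᵀ Γ⁻¹ η̃(t) is differentiable with V₁'(t) = −Σ_{i=1}^{m} zᵢ(t)ᵀ Qᵢ zᵢ(t) ≤ 0 for all t. -/
open Matrix

theorem hasDerivAt_quad {n : ℕ} (M : Matrix (Fin n) (Fin n) ℝ) (hM : M.IsSymm)
    (f : ℝ → Fin n → ℝ) (f' : Fin n → ℝ) (t : ℝ) (hf : HasDerivAt f f' t) :
    HasDerivAt (fun s => f s ⬝ᵥ M.mulVec (f s)) (2 * (M.mulVec (f t) ⬝ᵥ f')) t := by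
  have hc := hasDerivAt_pi.1 hf
  have h : HasDerivAt (fun s => f s ⬝ᵥ M.mulVec (f s))
      (f' ⬝ᵥ M.mulVec (f t) + f t ⬝ᵥ M.mulVec f') t := by
    simp only [dotProduct, mulVec, ← Finset.sum_add_distrib]
    refine HasDerivAt.fun_sum fun i _ => ?_
    refine (hc i).mul ?_
    exact HasDerivAt.fun_sum fun j _ => (hc j).const_mul _
  refine h.congr_deriv ?_
  symm
  have e : f t ⬝ᵥ M.mulVec f' = M.mulVec (f t) ⬝ᵥ f' := by
    rw [dotProduct_mulVec, ← mulVec_transpose, hM.eq]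
  rw [e, dotProduct_comm f']
  ring

theorem skew_cyc (w e b : Fin 3 → ℝ) :
    w ⬝ᵥ (skew e).mulVec b = e ⬝ᵥ (skew b).mulVec w := by
  simp [skew, dotProduct, mulVec, Fin.sum_univ_three]
  ring

/-- Lyapunov derivative identity for the direct-filter error
dynamics: along solutions of `zᵢ' = Aᵢ zᵢ + Bᵢ S(η̃) bᵢ`,
`η̃' = −Γ ∑ S(bᵢ) Bᵢᵀ Pᵢ zᵢ`, with `AᵢᵀPᵢ + PᵢAᵢ = −Qᵢ`, the function
`V₁ = ∑ zᵢᵀPᵢzᵢ + η̃ᵀΓ⁻¹η̃` satisfies `V₁' = −∑ zᵢᵀQᵢzᵢ ≤ 0`. -/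
theorem stmt10 (m N : ℕ) (hm : 1 ≤ m) (hN : 1 ≤ N)
    (A : Fin m → Matrix (Fin N) (Fin N) ℝ)
    (B : Fin m → Matrix (Fin N) (Fin 3) ℝ)
    (P Q : Fin m → Matrix (Fin N) (Fin N) ℝ)
    (hP : ∀ i, (P i).IsSymm) (hQ : ∀ i, (Q i).PosSemidef)
    (hLyap : ∀ i, (A i)ᵀ * P i + P i * A i = -(Q i))
    (Γ : Matrix (Fin 3) (Fin 3) ℝ) (hΓ : Γ.PosDef) (hΓs : Γ.IsSymm)
    (b : Fin m → ℝ → Fin 3 → ℝ)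
    (z : Fin m → ℝ → Fin N → ℝ) (η : ℝ → Fin 3 → ℝ)
    (hz : ∀ i t, HasDerivAt (z i)
      ((A i).mulVec (z i t) + (B i).mulVec ((skew (η t)).mulVec (b i t))) t)
    (hη : ∀ t, HasDerivAt η
      (-(Γ.mulVec (∑ i, (skew (b i t)).mulVec ((B i)ᵀ.mulVec
        ((P i).mulVec (z i t)))))) t) :
    ∀ t, HasDerivAt
        (fun s => ∑ i, z i s ⬝ᵥ (P i).mulVec (z i s) +
          η s ⬝ᵥ Γ⁻¹.mulVec (η s))
        (-∑ i, z i t ⬝ᵥ (Q i).mulVec (z i t)) t ∧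
      -∑ i, z i t ⬝ᵥ (Q i).mulVec (z i t) ≤ 0 := by
  intro t
  constructor
  · have hs : HasDerivAt (fun s => ∑ i, z i s ⬝ᵥ (P i).mulVec (z i s)) _ t :=
      HasDerivAt.fun_sum fun i _ => hasDerivAt_quad (P i) (hP i) (z i) _ t (hz i t)
    have hΓi : (Γ⁻¹).IsSymm := by
      unfold Matrix.IsSymm
      rw [Matrix.transpose_nonsing_inv, hΓs.eq]
    have he := hasDerivAt_quad Γ⁻¹ hΓi η _ t (hη t)
    have hdet : IsUnit Γ.det := hΓ.det_pos.ne'.isUnit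
    refine (hs.fun_add he).congr_deriv ?_
    symm
    have h1 : ∀ u : Fin 3 → ℝ, Γ⁻¹.mulVec (η t) ⬝ᵥ Γ.mulVec u = η t ⬝ᵥ u := by
      intro u
      rw [dotProduct_mulVec, ← mulVec_transpose, hΓs.eq, mulVec_mulVec,
        Matrix.mul_nonsing_inv _ hdet, one_mulVec]
    rw [dotProduct_neg, h1, dotProduct_sum, mul_neg, Finset.mul_sum, ← sub_eq_add_neg,
      ← Finset.sum_sub_distrib, ← Finset.sum_neg_distrib]
    refine Finset.sum_congr rfl fun i _ => ?_
    have h2 : (P i).mulVec (z i t) ⬝ᵥ (B i).mulVec ((skew (η t)).mulVec (b i t)) =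
        η t ⬝ᵥ (skew (b i t)).mulVec ((B i)ᵀ.mulVec ((P i).mulVec (z i t))) := by
      rw [dotProduct_mulVec, ← mulVec_transpose, skew_cyc]
    have h3 : z i t ⬝ᵥ ((A i)ᵀ * P i).mulVec (z i t) =
        (P i).mulVec (z i t) ⬝ᵥ (A i).mulVec (z i t) := by
      rw [← mulVec_mulVec, dotProduct_mulVec, vecMul_transpose, dotProduct_comm]
    have h4 : z i t ⬝ᵥ (P i * A i).mulVec (z i t) =
        (P i).mulVec (z i t) ⬝ᵥ (A i).mulVec (z i t) := by
      rw [← mulVec_mulVec, dotProduct_mulVec, ← mulVec_transpose, (hP i).eq]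
    have h5 : -(z i t ⬝ᵥ (Q i).mulVec (z i t)) =
        z i t ⬝ᵥ ((A i)ᵀ * P i).mulVec (z i t) + z i t ⬝ᵥ (P i * A i).mulVec (z i t) := by
      rw [← dotProduct_add, ← add_mulVec, hLyap i, neg_mulVec, dotProduct_neg]
    rw [h5, h3, h4, dotProduct_add, h2]
    ring
  · rw [neg_nonpos]
    refine Finset.sum_nonneg fun i _ => ?_
    simpa using (hQ i).dotProduct_mulVec_nonneg (z i t)
end

section
/- (Direct filter, Proposition 1.) Let n ≥ 1 and m ≥ 2. Let r₁,…,rₘ ∈ ℝ³ with at least two linearly independent, let ω : ℝ → ℝ³ be continuous and bounded, let R : ℝ → SO(3) be differentiable with R'(t) = R(t) S(ω(t)), and set bᵢ(t) = R(t)ᵀ rᵢ. For each i, let γᵢ = (γ_{i1},…,γ_{in}) ∈ ℝⁿ with P_{γᵢ} Hurwitz, let Aᵢ = A_{γᵢ} ⊗ I₃ ∈ ℝ^{3n×3n} (companion matrix of P_{γᵢ} Kronecker the 3×3 identity), Bᵢ = γ_{in}(eₙ ⊗ I₃) ∈ ℝ^{3n×3} with eₙ = (0,…,0,1)ᵀ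 ∈ ℝⁿ, let Qᵢ ∈ ℝ^{3n×3n} be symmetric positive definite and Pᵢ the symmetric positive definite solution of AᵢᵀPᵢ + PᵢAᵢ = −Qᵢ, and let Γ ∈ ℝ^{3×3} be a positive definite diagonal matrix. Suppose zᵢ : ℝ → ℝ^{3n} and η̃ : ℝ → ℝ³ are differentiable and satisfy the error dynamics zᵢ'(t) = Aᵢ zᵢ(t) + Bᵢ S(η̃(t)) bᵢ(t) and η̃'(t) = −Γ Σ_{i=1}^{m} S(bᵢ(t)) Bᵢᵀ Pᵢ zᵢ(t) for all t ≥ 0. Then zᵢ(t) → 0 for each i and η̃(t) → 0 as t → ∞. -/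
open Polynomial Matrix Kronecker

attribute [local instance] Matrix.normedAddCommGroup Matrix.normedSpace

/-- `Pgamma n γ` is the monic polynomial `s^n + ∑_{k=1}^{n} γ_k s^{n-k}`. -/
noncomputable def Pgamma (n : ℕ) (γ : Fin n → ℝ) : Polynomial ℝ :=
  X ^ n + ∑ k : Fin n, C (γ k) * X ^ (n - (k.val + 1))

/-- A real polynomial is Hurwitz if all its complex roots have strictly
negative real part. -/
def IsHurwitz (p : Polynomial ℝ) : Prop :=
  ∀ z : ℂ, (p.map (algebraMap ℝ ℂ)).IsRoot z → z.re < 0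

/-- The companion matrix `A_γ`: ones on the superdiagonal, last row
`(−γₙ, −γ_{n−1}, …, −γ₁)`. -/
def companionMatrix (n : ℕ) (γ : Fin n → ℝ) : Matrix (Fin n) (Fin n) ℝ :=
  Matrix.of fun i j =>
    if i.val + 1 = n then -γ ⟨n - 1 - j.val, by have := j.isLt; omega⟩
    else if j.val = i.val + 1 then 1 else 0

/-- bounded on the nonnegative half line -/
def Bd (f : ℝ → ℝ) : Prop := ∃ C, ∀ t ≥ (0:ℝ), |f t| ≤ C

/-- bounded and Lipschitz on the nonnegative half line -/
def BL (f : ℝ → ℝ) : Prop :=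
  Bd f ∧ ∃ C, ∀ s ≥ (0:ℝ), ∀ t ≥ (0:ℝ), |f s - f t| ≤ C * |s - t|

lemma Bd.const (c : ℝ) : Bd (fun _ => c) := ⟨|c|, fun _ _ => le_rfl⟩

lemma Bd.add {f g : ℝ → ℝ} (hf : Bd f) (hg : Bd g) : Bd (fun t => f t + g t) := by
  obtain ⟨C, hC⟩ := hf
  obtain ⟨D, hD⟩ := hg
  exact ⟨C + D, fun t ht => (abs_add_le _ _).trans (add_le_add (hC t ht) (hD t ht))⟩

lemma Bd.mul {f g : ℝ → ℝ} (hf : Bd f) (hg : Bd g) : Bd (fun t => f t * g t) := by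
  obtain ⟨C, hC⟩ := hf
  obtain ⟨D, hD⟩ := hg
  refine ⟨C * D, fun t ht => ?_⟩
  rw [abs_mul]
  exact mul_le_mul (hC t ht) (hD t ht) (abs_nonneg _) ((abs_nonneg _).trans (hC t ht))

lemma Bd.neg {f : ℝ → ℝ} (hf : Bd f) : Bd (fun t => - f t) := by
  obtain ⟨C, hC⟩ := hf
  exact ⟨C, fun t ht => by rw [abs_neg]; exact hC t ht⟩

lemma Bd.sum {ι : Type*} (s : Finset ι) {f : ι → ℝ → ℝ} (hf : ∀ i, Bd (f i)) :
    Bd (fun t => ∑ i ∈ s, f i t) := by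
  classical
  induction s using Finset.induction_on with
  | empty => simpa using Bd.const 0
  | insert a s ha ih =>
    simp only [Finset.sum_insert ha]
    exact (hf a).add ih

lemma BL.const (c : ℝ) : BL (fun _ => c) := ⟨Bd.const c, 0, fun _ _ _ _ => by simp⟩

lemma BL.add {f g : ℝ → ℝ} (hf : BL f) (hg : BL g) : BL (fun t => f t + g t) := by
  obtain ⟨hf0, C, hC⟩ := hf
  obtain ⟨hg0, D, hD⟩ := hg
  refine ⟨hf0.add hg0, C + D, fun s hs t ht => ?_⟩
  have h : f s + g s - (f t + g t) = (f s - f t) + (g s - g t) := by ring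
  rw [h, add_mul]
  exact (abs_add_le _ _).trans (add_le_add (hC s hs t ht) (hD s hs t ht))

lemma BL.mul {f g : ℝ → ℝ} (hf : BL f) (hg : BL g) : BL (fun t => f t * g t) := by
  obtain ⟨hf0, C, hC⟩ := hf
  obtain ⟨hg0, D, hD⟩ := hg
  refine ⟨hf0.mul hg0, ?_⟩
  obtain ⟨C', hC'⟩ := hf0
  obtain ⟨D', hD'⟩ := hg0
  refine ⟨C' * D + C * D', fun s hs t ht => ?_⟩
  have h : f s * g s - f t * g t = f s * (g s - g t) + (f s - f t) * g t := by ring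
  rw [h]
  refine (abs_add_le _ _).trans ?_
  rw [abs_mul, abs_mul]
  have h1 : |f s| * |g s - g t| ≤ C' * (D * |s - t|) :=
    mul_le_mul (hC' s hs) (hD s hs t ht) (abs_nonneg _) ((abs_nonneg _).trans (hC' s hs))
  have h2 : |f s - f t| * |g t| ≤ (C * |s - t|) * D' :=
    mul_le_mul (hC s hs t ht) (hD' t ht) (abs_nonneg _) ((abs_nonneg _).trans (hC s hs t ht))
  nlinarith

lemma BL.neg {f : ℝ → ℝ} (hf : BL f) : BL (fun t => - f t) := by
  simpa using (BL.const (-1)).mul hf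

lemma BL.sum {ι : Type*} (s : Finset ι) {f : ι → ℝ → ℝ} (hf : ∀ i, BL (f i)) :
    BL (fun t => ∑ i ∈ s, f i t) := by
  classical
  induction s using Finset.induction_on with
  | empty => simpa using BL.const 0
  | insert a s ha ih =>
    simp only [Finset.sum_insert ha]
    exact (hf a).add ih

lemma BL.of_deriv {f g : ℝ → ℝ} (hf : Bd f) (hg : Bd g)
    (h : ∀ t ≥ (0:ℝ), HasDerivAt f (g t) t) : BL f := by
  refine ⟨hf, ?_⟩
  obtain ⟨C, hC⟩ := hg
  refine ⟨C, fun s hs t ht => ?_⟩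
  have := (convex_Ici (0:ℝ)).norm_image_sub_le_of_norm_hasDerivWithin_le (f := f) (f' := g)
    (C := C) (x := t) (y := s) (fun x hx => (h x hx).hasDerivWithinAt)
    (fun x hx => hC x hx) ht hs
  simpa [Real.norm_eq_abs] using this

lemma Bd.mul_tendsto {f g : ℝ → ℝ} (hf : Bd f)
    (hg : Filter.Tendsto g Filter.atTop (nhds 0)) :
    Filter.Tendsto (fun t => f t * g t) Filter.atTop (nhds 0) := by
  obtain ⟨C, hC⟩ := hf
  have h1 : Filter.Tendsto (fun t => C * |g t|) Filter.atTop (nhds 0) := by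
    simpa using hg.abs.const_mul C
  refine squeeze_zero_norm' ?_ h1
  filter_upwards [Filter.eventually_ge_atTop (0:ℝ)] with t ht
  rw [Real.norm_eq_abs, abs_mul]
  exact mul_le_mul_of_nonneg_right (hC t ht) (abs_nonneg _)

/-- Barbalat -/
lemma barbalat {f g : ℝ → ℝ} {c : ℝ} (h : ∀ t ≥ (0:ℝ), HasDerivAt f (g t) t)
    (hg : BL g) (hf : Filter.Tendsto f Filter.atTop (nhds c)) :
    Filter.Tendsto g Filter.atTop (nhds 0) := by
  obtain ⟨-, C, hC⟩ := hg
  rw [Metric.tendsto_atTop]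
  intro ε hε
  set K := |C| + 1 with hK
  have hK0 : 0 < K := by positivity
  set d := ε / (2 * K) with hd
  have hd0 : 0 < d := by positivity
  have hKd : K * d = ε / 2 := by rw [hd]; field_simp
  have hfin : Filter.Tendsto (fun t => f (t + d) - f t) Filter.atTop (nhds 0) := by
    have := (hf.comp (Filter.tendsto_atTop_add_const_right Filter.atTop d Filter.tendsto_id)).sub hf
    simpa using this
  rw [Metric.tendsto_atTop] at hfin
  obtain ⟨N, hN⟩ := hfin (d * (ε / 2)) (by positivity)
  refine ⟨max N 0, fun t ht => ?_⟩
  have htN : N ≤ t := (le_max_left _ _).trans ht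
  have ht0 : 0 ≤ t := (le_max_right _ _).trans ht
  obtain ⟨x, hx, hxe⟩ := exists_hasDerivAt_eq_slope f g (show t < t + d by linarith)
    (fun y hy => (h y (ht0.trans hy.1)).continuousAt.continuousWithinAt)
    (fun y hy => h y (ht0.trans hy.1.le))
  have h1 := hN t htN
  rw [Real.dist_eq, sub_zero] at h1 ⊢
  have h2 : f (t + d) - f t = d * g x := by
    rw [hxe, add_sub_cancel_left, mul_div_cancel₀ _ hd0.ne']
  rw [h2, abs_mul, abs_of_pos hd0] at h1
  have h3 : |g x| < ε / 2 := lt_of_mul_lt_mul_left h1 hd0.le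
  have h4 := hC t ht0 x (ht0.trans hx.1.le)
  have h5 : |t - x| ≤ d := by
    rw [abs_le]; constructor <;> linarith [hx.1, hx.2]
  have h6 : C * |t - x| ≤ K * d :=
    mul_le_mul (by rw [hK]; linarith [le_abs_self C]) h5 (abs_nonneg _) hK0.le
  have h7 : |g t| ≤ |g t - g x| + |g x| := by
    have := abs_add_le (g t - g x) (g x)
    simpa using this
  linarith

lemma tendsto_of_antitone_bdd {V W : ℝ → ℝ} (hV : ∀ t, 0 ≤ V t)
    (h : ∀ t ≥ (0:ℝ), HasDerivAt V (-W t) t) (hW : ∀ t, 0 ≤ W t) :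
    (∀ t ≥ (0:ℝ), V t ≤ V 0) ∧ ∃ c, Filter.Tendsto V Filter.atTop (nhds c) := by
  have hanti : AntitoneOn V (Set.Ici 0) := by
    refine antitoneOn_of_deriv_nonpos (convex_Ici 0)
      (fun x hx => (h x hx).continuousAt.continuousWithinAt)
      (fun x hx => ?_) (fun x hx => ?_)
    · rw [interior_Ici] at hx
      exact (h x (le_of_lt hx)).differentiableAt.differentiableWithinAt
    · rw [interior_Ici] at hx
      rw [(h x (le_of_lt hx)).deriv]
      linarith [hW x]
  refine ⟨fun t ht => hanti (Set.mem_Ici.2 le_rfl) ht ht, ?_⟩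
  have h2 : Antitone (fun t => V (max t 0)) := fun s t hst =>
    hanti (Set.mem_Ici.2 (le_max_right _ _)) (Set.mem_Ici.2 (le_max_right _ _)) (max_le_max_right 0 hst)
  refine ⟨_, (tendsto_atTop_ciInf h2 ⟨0, ?_⟩).congr' ?_⟩
  · rintro _ ⟨t, rfl⟩; exact hV _
  · filter_upwards [Filter.eventually_ge_atTop (0:ℝ)] with t ht
    simp [max_eq_left ht]

lemma posDef_lower {ι : Type*} [Fintype ι] [DecidableEq ι] {M : Matrix ι ι ℝ} (hM : M.PosDef) :
    ∃ c > 0, ∀ x : ι → ℝ, ∀ p, c * x p ^ 2 ≤ x ⬝ᵥ (M *ᵥ x) := by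
  have hcont : Continuous (fun x : ι → ℝ => x ⬝ᵥ (M *ᵥ x)) := by
    simp only [dotProduct, Matrix.mulVec]; fun_prop
  have hpos : ∀ x : ι → ℝ, x ≠ 0 → 0 < x ⬝ᵥ (M *ᵥ x) := fun x hx => by
    simpa using hM.dotProduct_mulVec_pos hx
  have key : ∃ c > 0, ∀ x ∈ Metric.sphere (0 : ι → ℝ) 1, c ≤ x ⬝ᵥ (M *ᵥ x) := by
    rcases (Metric.sphere (0 : ι → ℝ) 1).eq_empty_or_nonempty with he | hne
    · exact ⟨1, one_pos, fun x hx => by rw [he] at hx; exact hx.elim⟩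
    · obtain ⟨y, hy, hmin⟩ := (isCompact_sphere (0 : ι → ℝ) 1).exists_isMinOn hne hcont.continuousOn
      refine ⟨_, hpos y ?_, fun x hx => hmin hx⟩
      rintro rfl
      simp at hy
  obtain ⟨c, hc, hcx⟩ := key
  refine ⟨c, hc, fun x p => ?_⟩
  by_cases hx : x = 0
  · simp [hx]
  have hn : 0 < ‖x‖ := norm_pos_iff.2 hx
  have h1 := hcx (‖x‖⁻¹ • x) (by simp [norm_smul, hn.ne'])
  rw [Matrix.mulVec_smul, smul_dotProduct, dotProduct_smul, smul_eq_mul, smul_eq_mul] at h1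
  have h2 : c * ‖x‖ ^ 2 ≤ x ⬝ᵥ (M *ᵥ x) := by
    have h3 := mul_le_mul_of_nonneg_right h1 (sq_nonneg ‖x‖)
    calc _ ≤ _ := h3
      _ = _ := by field_simp
  refine le_trans (mul_le_mul_of_nonneg_left ?_ hc.le) h2
  have h4 : |x p| ≤ ‖x‖ := norm_le_pi_norm x p
  rw [← sq_abs]
  exact pow_le_pow_left₀ (abs_nonneg _) h4 2

lemma hasDerivAt_dot {ι : Type*} [Fintype ι] {x y : ℝ → ι → ℝ} {x' y' : ι → ℝ} {t : ℝ}
    (hx : HasDerivAt x x' t) (hy : HasDerivAt y y' t) :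
    HasDerivAt (fun s => x s ⬝ᵥ y s) (x' ⬝ᵥ y t + x t ⬝ᵥ y') t := by
  rw [hasDerivAt_pi] at hx hy
  simp only [dotProduct, ← Finset.sum_add_distrib]
  exact HasDerivAt.fun_sum fun i _ => (hx i).mul (hy i)

lemma hasDerivAt_mulVec {ι κ : Type*} [Fintype ι] [Fintype κ] (M : Matrix κ ι ℝ)
    {x : ℝ → ι → ℝ} {x' : ι → ℝ} {t : ℝ}
    (hx : HasDerivAt x x' t) : HasDerivAt (fun s => M *ᵥ x s) (M *ᵥ x') t := by
  rw [hasDerivAt_pi] at hx ⊢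
  intro i
  simp only [Matrix.mulVec, dotProduct]
  exact HasDerivAt.fun_sum fun j _ => (hx j).const_mul _

lemma quad_lyap {ι : Type*} [Fintype ι] [DecidableEq ι] {A P Q : Matrix ι ι ℝ}
    {B : Matrix ι (Fin 3) ℝ} (hP : Pᵀ = P) (h : Aᵀ * P + P * A = -Q) (x : ι → ℝ) (u : Fin 3 → ℝ) :
    (A *ᵥ x + B *ᵥ u) ⬝ᵥ (P *ᵥ x) + x ⬝ᵥ (P *ᵥ (A *ᵥ x + B *ᵥ u)) =
      -(x ⬝ᵥ (Q *ᵥ x)) + 2 * (u ⬝ᵥ (Bᵀ *ᵥ (P *ᵥ x))) := by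
  have e1 : (A *ᵥ x) ⬝ᵥ (P *ᵥ x) = x ⬝ᵥ ((Aᵀ * P) *ᵥ x) := by
    rw [← Matrix.mulVec_mulVec, Matrix.dotProduct_mulVec x, Matrix.vecMul_transpose]
  have e2 : (B *ᵥ u) ⬝ᵥ (P *ᵥ x) = u ⬝ᵥ (Bᵀ *ᵥ (P *ᵥ x)) := by
    rw [Matrix.dotProduct_mulVec u, Matrix.vecMul_transpose]
  have e3 : x ⬝ᵥ (P *ᵥ (B *ᵥ u)) = u ⬝ᵥ (Bᵀ *ᵥ (P *ᵥ x)) := by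
    rw [← e2, Matrix.dotProduct_mulVec x, ← Matrix.mulVec_transpose, hP, dotProduct_comm]
  have e4 : x ⬝ᵥ (P *ᵥ (A *ᵥ x)) = x ⬝ᵥ ((P * A) *ᵥ x) := by rw [Matrix.mulVec_mulVec]
  have e5 : x ⬝ᵥ ((Aᵀ * P) *ᵥ x) + x ⬝ᵥ ((P * A) *ᵥ x) = -(x ⬝ᵥ (Q *ᵥ x)) := by
    rw [← dotProduct_add, ← Matrix.add_mulVec, h, Matrix.neg_mulVec, dotProduct_neg]
  rw [add_dotProduct, Matrix.mulVec_add, dotProduct_add, e1, e2, e3, e4]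
  linarith

lemma skew_adj (η b w : Fin 3 → ℝ) :
    ((skew η) *ᵥ b) ⬝ᵥ w = η ⬝ᵥ ((skew b) *ᵥ w) := by
  simp [skew, Matrix.mulVec, dotProduct, Fin.sum_univ_three]
  ring

lemma Bd.mulVec {ι κ : Type*} [Fintype ι] (M : ℝ → Matrix κ ι ℝ) (x : ℝ → ι → ℝ)
    (hM : ∀ k i, Bd (fun t => M t k i)) (hx : ∀ i, Bd (fun t => x t i)) (k : κ) :
    Bd (fun t => (M t *ᵥ x t) k) := by
  simp only [Matrix.mulVec, dotProduct]
  exact Bd.sum _ fun i => (hM k i).mul (hx i)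

lemma BL.mulVec {ι κ : Type*} [Fintype ι] (M : ℝ → Matrix κ ι ℝ) (x : ℝ → ι → ℝ)
    (hM : ∀ k i, BL (fun t => M t k i)) (hx : ∀ i, BL (fun t => x t i)) (k : κ) :
    BL (fun t => (M t *ᵥ x t) k) := by
  simp only [Matrix.mulVec, dotProduct]
  exact BL.sum _ fun i => (hM k i).mul (hx i)

lemma Bd.skew {x : ℝ → Fin 3 → ℝ} (hx : ∀ i, Bd (fun t => x t i)) (k i : Fin 3) :
    Bd (fun t => skew (x t) k i) := by
  fin_cases k <;> fin_cases i <;> simp [_root_.skew] <;>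
  first
  | exact Bd.const 0
  | exact hx _
  | exact (hx _).neg

lemma BL.skew {x : ℝ → Fin 3 → ℝ} (hx : ∀ i, BL (fun t => x t i)) (k i : Fin 3) :
    BL (fun t => skew (x t) k i) := by
  fin_cases k <;> fin_cases i <;> simp [_root_.skew] <;>
  first
  | exact BL.const 0
  | exact hx _
  | exact (hx _).neg

lemma gram_recover (e a c : Fin 3 → ℝ) (k : Fin 3) :
    ((a ⬝ᵥ a) * (c ⬝ᵥ c) - (a ⬝ᵥ c) ^ 2) * e k =
      (skew a *ᵥ c) k * (c ⬝ᵥ (skew e *ᵥ a)) + a k * ((skew a *ᵥ c) ⬝ᵥ (skew e *ᵥ c))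
        + (-c k) * ((skew a *ᵥ c) ⬝ᵥ (skew e *ᵥ a)) := by
  fin_cases k <;> simp [skew, Matrix.mulVec, dotProduct, Fin.sum_univ_three] <;> ring

lemma gram_pos {a c : Fin 3 → ℝ} (h : LinearIndependent ℝ ![a, c]) :
    (a ⬝ᵥ a) * (c ⬝ᵥ c) - (a ⬝ᵥ c) ^ 2 ≠ 0 := by
  have h1 := crossProduct_ne_zero_iff_linearIndependent.2 h
  intro h0
  apply h1
  have h2 : (crossProduct a c) ⬝ᵥ (crossProduct a c) = 0 := by
    rw [← h0]
    simp [cross_apply, dotProduct, Fin.sum_univ_three]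
    ring
  exact dotProduct_self_eq_zero.1 h2

lemma gamma_ne {n : ℕ} (hn : 1 ≤ n) {γ : Fin n → ℝ} (h : IsHurwitz (Pgamma n γ)) :
    γ ⟨n - 1, Nat.sub_lt hn one_pos⟩ ≠ 0 := by
  intro h0
  have h1 := h 0
  have h2 : (Pgamma n γ).eval 0 = 0 := by
    simp only [Pgamma, eval_add, eval_pow, eval_X, eval_finsetSum, eval_mul, eval_C]
    rw [zero_pow (by omega), zero_add]
    refine Finset.sum_eq_zero fun k _ => ?_
    by_cases hk : k.val + 1 = n
    · have : k = ⟨n - 1, Nat.sub_lt hn one_pos⟩ := Fin.ext (by simp; omega)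
      rw [this, h0, zero_mul]
    · rw [zero_pow (by have := k.isLt; omega), mul_zero]
  have h3 : ((Pgamma n γ).map (algebraMap ℝ ℂ)).IsRoot 0 := by
    rw [IsRoot, eval_map_algebraMap]
    have := aeval_algebraMap_apply ℂ (0:ℝ) (Pgamma n γ)
    simpa [h2] using this
  simpa using h1 h3

lemma Tendsto0.dot {x y : ℝ → Fin 3 → ℝ} (hx : ∀ k, Bd (fun t => x t k))
    (hy : ∀ k, Filter.Tendsto (fun t => y t k) Filter.atTop (nhds 0)) :
    Filter.Tendsto (fun t => x t ⬝ᵥ y t) Filter.atTop (nhds 0) := by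
  simp only [dotProduct]
  have := tendsto_finsetSum (Finset.univ : Finset (Fin 3))
    (fun k _ => (hx k).mul_tendsto (hy k))
  simpa using this

/-- Proposition 1, direct filter: under the stated assumptions
the error dynamics `zᵢ' = Aᵢ zᵢ + Bᵢ S(η̃) bᵢ`,
`η̃' = −Γ ∑ S(bᵢ) Bᵢᵀ Pᵢ zᵢ` (for `t ≥ 0`) satisfy `zᵢ(t) → 0` and
`η̃(t) → 0` as `t → ∞`. The state space `ℝ^{3n}` is realized as
`Fin n × Fin 3 → ℝ`, `Aᵢ = A_{γᵢ} ⊗ I₃` and `Bᵢ = γᵢₙ (eₙ ⊗ I₃)`. -/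
theorem stmt11 (n m : ℕ) (hn : 1 ≤ n) (hm : 2 ≤ m)
    (r : Fin m → Fin 3 → ℝ)
    (hr : ∃ i j : Fin m, i ≠ j ∧ LinearIndependent ℝ ![r i, r j])
    (ω : ℝ → Fin 3 → ℝ) (hωc : Continuous ω) (hωb : ∃ M, ∀ t, ‖ω t‖ ≤ M)
    (R : ℝ → Matrix (Fin 3) (Fin 3) ℝ)
    (hRO : ∀ t, (R t)ᵀ * R t = 1) (hRdet : ∀ t, (R t).det = 1)
    (hR : ∀ t, HasDerivAt R (R t * skew (ω t)) t)
    (b : Fin m → ℝ → Fin 3 → ℝ) (hb : ∀ i t, b i t = (R t)ᵀ.mulVec (r i))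
    (γ : Fin m → Fin n → ℝ) (hγ : ∀ i, IsHurwitz (Pgamma n (γ i)))
    (A : Fin m → Matrix (Fin n × Fin 3) (Fin n × Fin 3) ℝ)
    (hA : ∀ i, A i = (companionMatrix n (γ i)) ⊗ₖ (1 : Matrix (Fin 3) (Fin 3) ℝ))
    (B : Fin m → Matrix (Fin n × Fin 3) (Fin 3) ℝ)
    (hB : ∀ i, B i = Matrix.of fun p j =>
      if p.1.val + 1 = n ∧ p.2 = j then γ i ⟨n - 1, Nat.sub_lt hn one_pos⟩ else 0)
    (P Q : Fin m → Matrix (Fin n × Fin 3) (Fin n × Fin 3) ℝ)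
    (hQ : ∀ i, (Q i).PosDef) (hP : ∀ i, (P i).PosDef)
    (hLyap : ∀ i, (A i)ᵀ * P i + P i * A i = -(Q i))
    (Γ : Matrix (Fin 3) (Fin 3) ℝ) (hΓ : Γ.PosDef)
    (hΓd : ∀ p q : Fin 3, p ≠ q → Γ p q = 0)
    (z : Fin m → ℝ → Fin n × Fin 3 → ℝ) (η : ℝ → Fin 3 → ℝ)
    (hz : ∀ i, ∀ t ≥ (0 : ℝ), HasDerivAt (z i)
      ((A i).mulVec (z i t) + (B i).mulVec ((skew (η t)).mulVec (b i t))) t)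
    (hη : ∀ t ≥ (0 : ℝ), HasDerivAt η
      (-(Γ.mulVec (∑ i, (skew (b i t)).mulVec ((B i)ᵀ.mulVec
        ((P i).mulVec (z i t)))))) t) :
    (∀ i, Filter.Tendsto (z i) Filter.atTop (nhds 0)) ∧
      Filter.Tendsto η Filter.atTop (nhds 0) := by
  
  have hzp : ∀ i t, t ≥ (0:ℝ) → ∀ p, HasDerivAt (fun s => z i s p)
      (((A i) *ᵥ (z i t)) p + ((B i) *ᵥ ((skew (η t)) *ᵥ (b i t))) p) t :=
    fun i t ht p => (hasDerivAt_pi.1 (hz i t ht)) p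
  have hΓmul : ∀ (x : Fin 3 → ℝ) k, (Γ *ᵥ x) k = Γ k k * x k := by
    intro x k
    rw [Matrix.mulVec, dotProduct]
    exact Finset.sum_eq_single k (fun j _ hj => by rw [hΓd k j hj.symm, zero_mul]) (by simp)
  have hηk : ∀ t, t ≥ (0:ℝ) → ∀ k, HasDerivAt (fun s => η s k)
      (-(Γ k k * (∑ i, (skew (b i t)) *ᵥ ((B i)ᵀ *ᵥ ((P i) *ᵥ (z i t)))) k)) t := by
    intro t ht k
    have := (hasDerivAt_pi.1 (hη t ht)) k
    rwa [Pi.neg_apply, hΓmul] at this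
  have hΓpos : ∀ k, 0 < Γ k k := fun k => hΓ.diag_pos
  have hRR : ∀ t, R t * (R t)ᵀ = 1 := fun t => mul_eq_one_comm.1 (hRO t)
  -- boundedness of `R`
  have hRbd : ∀ k l, Bd (fun t => R t k l) := by
    intro k l
    refine ⟨1, fun t _ => ?_⟩
    have h1 : ∑ j, R t k j * R t k j = 1 := by
      have := congrFun (congrFun (hRR t) k) k
      simpa [Matrix.mul_apply] using this
    have h2 : R t k l * R t k l ≤ 1 := by
      rw [← h1]
      exact Finset.single_le_sum (f := fun j => R t k j * R t k j)
        (fun j _ => mul_self_nonneg _) (Finset.mem_univ l)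
    rw [abs_le]
    constructor <;> nlinarith
  have hωbd : ∀ k, Bd (fun t => ω t k) := by
    obtain ⟨M, hM⟩ := hωb
    exact fun k => ⟨M, fun t _ => (norm_le_pi_norm (ω t) k).trans (hM t)⟩
  have hRd : ∀ k l t, HasDerivAt (fun s => R s k l) ((R t * skew (ω t)) k l) t := fun k l t =>
    (hasDerivAt_pi.1 ((hasDerivAt_pi.1 (hR t)) k)) l
  have hRBL : ∀ k l, BL (fun t => R t k l) := by
    intro k l
    refine BL.of_deriv (hRbd k l) (g := fun t => (R t * skew (ω t)) k l) ?_ (fun t _ => hRd k l t)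
    simp only [Matrix.mul_apply]
    exact Bd.sum _ fun j => (hRbd k j).mul (Bd.skew hωbd j l)
  have hbBL : ∀ i k, BL (fun t => b i t k) := by
    intro i k
    simp only [hb]
    exact BL.mulVec (fun t => (R t)ᵀ) (fun _ => r i) (fun k l => hRBL l k) (fun l => BL.const _) k
  -- Lyapunov function
  set V : ℝ → ℝ := fun t => (∑ i, z i t ⬝ᵥ (P i *ᵥ z i t)) + ∑ k, (Γ k k)⁻¹ * (η t k * η t k)
    with hVdef
  set W : ℝ → ℝ := fun t => ∑ i, z i t ⬝ᵥ (Q i *ᵥ z i t) with hWdef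
  have hPnn : ∀ i t, 0 ≤ z i t ⬝ᵥ (P i *ᵥ z i t) := fun i t => by
    simpa using (hP i).posSemidef.dotProduct_mulVec_nonneg (z i t)
  have hQnn : ∀ i t, 0 ≤ z i t ⬝ᵥ (Q i *ᵥ z i t) := fun i t => by
    simpa using (hQ i).posSemidef.dotProduct_mulVec_nonneg (z i t)
  have hηnn : ∀ k t, 0 ≤ (Γ k k)⁻¹ * (η t k * η t k) := fun k t =>
    mul_nonneg (inv_nonneg.2 (hΓpos k).le) (mul_self_nonneg _)
  have hVnn : ∀ t, 0 ≤ V t := fun t =>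
    add_nonneg (Finset.sum_nonneg fun i _ => hPnn i t) (Finset.sum_nonneg fun k _ => hηnn k t)
  have hWnn : ∀ t, 0 ≤ W t := fun t => Finset.sum_nonneg fun i _ => hQnn i t
  have hPsym : ∀ i, (P i)ᵀ = P i := fun i => by simpa using (hP i).isHermitian.eq
  have hVd : ∀ t ≥ (0:ℝ), HasDerivAt V (-W t) t := by
    intro t ht
    have h1 : HasDerivAt (fun s => ∑ i, z i s ⬝ᵥ (P i *ᵥ z i s)) _ t :=
      HasDerivAt.fun_sum fun i (_ : i ∈ Finset.univ) =>
        hasDerivAt_dot (hz i t ht) (hasDerivAt_mulVec (P i) (hz i t ht))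
    have h2 : HasDerivAt (fun s => ∑ k, (Γ k k)⁻¹ * (η s k * η s k)) _ t :=
      HasDerivAt.fun_sum fun k (_ : k ∈ Finset.univ) =>
        ((hηk t ht k).mul (hηk t ht k)).const_mul ((Γ k k)⁻¹)
    refine (h1.add h2).congr_deriv ?_
    rw [Finset.sum_congr rfl (fun i _ => quad_lyap (hPsym i) (hLyap i) (z i t)
      ((skew (η t)) *ᵥ (b i t))), Finset.sum_add_distrib, Finset.sum_neg_distrib]
    set S := ∑ i, (skew (b i t)) *ᵥ ((B i)ᵀ *ᵥ ((P i) *ᵥ (z i t))) with hS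
    have e1 : ∑ i, 2 * (((skew (η t)) *ᵥ (b i t)) ⬝ᵥ ((B i)ᵀ *ᵥ (P i *ᵥ z i t)))
        = 2 * (η t ⬝ᵥ S) := by
      rw [← Finset.mul_sum, hS, dotProduct_sum]
      simp only [skew_adj]
    have e2 : ∑ k, (Γ k k)⁻¹ * (-(Γ k k * S k) * η t k + η t k * (-(Γ k k * S k)))
        = - (2 * (η t ⬝ᵥ S)) := by
      rw [dotProduct, Finset.mul_sum, ← Finset.sum_neg_distrib]
      refine Finset.sum_congr rfl fun k _ => ?_
      have := (hΓpos k).ne'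
      field_simp
      ring
    rw [e1, e2]
    simp only [hWdef]
    ring
  obtain ⟨hV0, c, hVc⟩ := tendsto_of_antitone_bdd hVnn hVd hWnn
  have hsqbd : ∀ (f : ℝ → ℝ) (c : ℝ), 0 < c → (∀ t ≥ (0:ℝ), c * f t ^ 2 ≤ V t) → Bd f := by
    intro f c hc h
    refine ⟨V 0 / c + 1, fun t ht => ?_⟩
    have h1 := (h t ht).trans (hV0 t ht)
    have h2 : f t ^ 2 ≤ V 0 / c := by rw [le_div_iff₀ hc]; linarith
    rw [← sq_abs] at h2
    nlinarith [sq_nonneg (|f t| - 1), abs_nonneg (f t)]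
  have hzbd : ∀ i p, Bd (fun t => z i t p) := by
    intro i p
    obtain ⟨c, hc, hcx⟩ := posDef_lower (hP i)
    refine hsqbd _ c hc fun t _ => (hcx (z i t) p).trans ?_
    have h1 := Finset.single_le_sum (f := fun i => z i t ⬝ᵥ (P i *ᵥ z i t))
        (fun j _ => hPnn j t) (Finset.mem_univ i)
    have h2 := Finset.sum_nonneg (s := Finset.univ) fun k _ => hηnn k t
    simp only [hVdef]
    linarith
  have hηbd : ∀ k, Bd (fun t => η t k) := by
    intro k
    refine hsqbd _ (Γ k k)⁻¹ (inv_pos.2 (hΓpos k)) fun t _ => ?_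
    have h1 := Finset.single_le_sum (f := fun k => (Γ k k)⁻¹ * (η t k * η t k))
        (fun j _ => hηnn j t) (Finset.mem_univ k)
    have h2 := Finset.sum_nonneg (s := Finset.univ) fun i _ => hPnn i t
    simp only [hVdef, sq] at h1 ⊢
    linarith
  have hconst : ∀ {ι κ : Type} (M : Matrix ι κ ℝ) k l, BL (fun _ => M k l) :=
    fun M k l => BL.const _
  have hzBL : ∀ i p, BL (fun t => z i t p) := by
    intro i p
    refine BL.of_deriv (hzbd i p) (Bd.add ?_ ?_) (fun t ht => hzp i t ht p)
    · exact Bd.mulVec (fun _ => A i) (z i) (fun _ _ => Bd.const _) (hzbd i) p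
    · exact Bd.mulVec (fun _ => B i) (fun t => skew (η t) *ᵥ b i t) (fun _ _ => Bd.const _)
        (Bd.mulVec (fun t => skew (η t)) (b i) (Bd.skew hηbd) fun k => (hbBL i k).1) p
  have hηBL : ∀ k, BL (fun t => η t k) := by
    intro k
    refine BL.of_deriv (hηbd k) (Bd.neg ((Bd.const _).mul ?_)) (fun t ht => hηk t ht k)
    simp only [Finset.sum_apply]
    refine Bd.sum _ fun i => ?_
    refine Bd.mulVec (fun t => skew (b i t)) _ (Bd.skew fun k => (hbBL i k).1) ?_ k
    refine Bd.mulVec (fun _ => (B i)ᵀ) _ (fun _ _ => Bd.const _) ?_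
    exact Bd.mulVec (fun _ => P i) _ (fun _ _ => Bd.const _) (hzbd i)
  have hWBL : BL W := by
    refine BL.sum _ fun i => ?_
    simp only [dotProduct]
    exact BL.sum _ fun p => (hzBL i p).mul
      (BL.mulVec (fun _ => Q i) (z i) (fun _ _ => BL.const _) (hzBL i) p)
  have hW0 : Filter.Tendsto W Filter.atTop (nhds 0) := by
    have := (barbalat hVd hWBL.neg hVc).neg
    simpa using this
  have hz0 : ∀ i p, Filter.Tendsto (fun t => z i t p) Filter.atTop (nhds 0) := by
    intro i p
    obtain ⟨c, hc, hcx⟩ := posDef_lower (hQ i)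
    have h1 : Filter.Tendsto (fun t => z i t p ^ 2) Filter.atTop (nhds 0) := by
      refine squeeze_zero (g := fun t => c⁻¹ * W t) (fun t => sq_nonneg _) (fun t => ?_)
        (by simpa using hW0.const_mul c⁻¹)
      have h2 := Finset.single_le_sum (f := fun i => z i t ⬝ᵥ (Q i *ᵥ z i t))
        (fun j _ => hQnn j t) (Finset.mem_univ i)
      have h3 := (hcx (z i t) p).trans h2
      rw [inv_mul_eq_div, le_div_iff₀ hc]
      linarith
    have h2 := h1.sqrt
    simp only [Real.sqrt_sq_eq_abs, Real.sqrt_zero] at h2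
    exact (tendsto_zero_iff_abs_tendsto_zero _).2 h2
  -- the regressor tends to zero
  have hu0 : ∀ i k, Filter.Tendsto (fun t => (skew (η t) *ᵥ b i t) k) Filter.atTop (nhds 0) := by
    intro i k
    have hdBL := fun p => BL.add (BL.mulVec (fun _ => A i) (z i) (fun _ _ => BL.const _) (hzBL i) p)
      (BL.mulVec (fun _ => B i) (fun t => skew (η t) *ᵥ b i t) (fun _ _ => BL.const _)
        (BL.mulVec (fun t => skew (η t)) (b i) (BL.skew hηBL) (hbBL i)) p)
    set p : Fin n × Fin 3 := (⟨n - 1, Nat.sub_lt hn one_pos⟩, k) with hp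
    have h1 := barbalat (fun t ht => hzp i t ht p) (hdBL p) (hz0 i p)
    have h2 : Filter.Tendsto (fun t => (A i *ᵥ z i t) p) Filter.atTop (nhds 0) := by
      simp only [Matrix.mulVec, dotProduct]
      simpa using tendsto_finsetSum Finset.univ
        (fun q _ => (hz0 i q).const_mul (A i p q))
    have h3 := h1.sub h2
    have hγ0 := gamma_ne hn (hγ i)
    have h4 : ∀ t, (B i *ᵥ (skew (η t) *ᵥ b i t)) p =
        γ i ⟨n - 1, Nat.sub_lt hn one_pos⟩ * (skew (η t) *ᵥ b i t) k := by
      intro t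
      rw [Matrix.mulVec, dotProduct, hB]
      rw [Finset.sum_eq_single k]
      · simp [hp, Nat.sub_add_cancel hn]
      · intro j _ hj
        simp [hp, hj.symm]
      · simp
    simp only [add_sub_cancel_left, h4, sub_zero] at h3
    have h5 := h3.const_mul (γ i ⟨n - 1, Nat.sub_lt hn one_pos⟩)⁻¹
    simpa [inv_mul_cancel_left₀ hγ0] using h5
  refine ⟨fun i => tendsto_pi_nhds.2 fun p => hz0 i p, tendsto_pi_nhds.2 fun k => ?_⟩
  obtain ⟨i, j, -, hij⟩ := hr
  have hG := gram_pos hij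
  have hdot : ∀ i j t, b i t ⬝ᵥ b j t = r i ⬝ᵥ r j := by
    intro i j t
    rw [hb, hb, Matrix.dotProduct_mulVec, Matrix.vecMul_transpose, Matrix.mulVec_mulVec, hRR,
      Matrix.one_mulVec]
  have hbb : ∀ i k, Bd (fun t => b i t k) := fun i k => (hbBL i k).1
  have hn1 : ∀ k, Bd (fun t => (skew (b i t) *ᵥ b j t) k) :=
    Bd.mulVec (fun t => skew (b i t)) (b j) (Bd.skew (hbb i)) (hbb j)
  have hfin := (((hn1 k).mul_tendsto (Tendsto0.dot (hbb j) (hu0 i))).add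
    ((hbb i k).mul_tendsto (Tendsto0.dot hn1 (hu0 j)))).add
    ((hbb j k).neg.mul_tendsto (Tendsto0.dot hn1 (hu0 i)))
  simp only [← gram_recover, hdot, add_zero] at hfin
  have h5 := hfin.const_mul ((r i ⬝ᵥ r i) * (r j ⬝ᵥ r j) - (r i ⬝ᵥ r j) ^ 2)⁻¹
  simpa [inv_mul_cancel_left₀ hG] using h5
end

section
/- Let m, N ≥ 1, and for i = 1,…,m let Aᵢ ∈ ℝ^{N×N}, Bᵢ ∈ ℝ^{N×3}, and let Pᵢ, Qᵢ ∈ ℝ^{N×N} be symmetric with Qᵢ positive semidefinite and AᵢᵀPᵢ + PᵢAᵢ = −Qᵢ; let Γ ∈ ℝ^{3×3} be symmetric positive definite. Suppose bᵢ, ω : ℝ → ℝ³ are any functions and Xᵢ : ℝ → ℝ^{N}, b̃ᵢ : ℝ → ℝ³, η̃ : ℝ → ℝ³ are differentiable with Xᵢ'(t) = Aᵢ Xᵢ(t) + Bᵢ b̃ᵢ(t), b̃ᵢ'(t) = −S(bᵢ(t)) η̃(t) + S(b̃ᵢ(t))(ω(t) + η̃(t)) − Bᵢᵀ Pᵢ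 Xᵢ(t), and η̃'(t) = −Γ Σ_{i=1}^{m} S(bᵢ(t)) b̃ᵢ(t). Then V₂(t) = Σ_{i=1}^{m} Xᵢ(t)ᵀ Pᵢ Xᵢ(t) + Σ_{i=1}^{m} ‖b̃ᵢ(t)‖² + η̃(t)ᵀ Γ⁻¹ η̃(t) is differentiable with V₂'(t) = −Σ_{i=1}^{m} Xᵢ(t)ᵀ Qᵢ Xᵢ(t) ≤ 0 for all t. -/
open Matrix

theorem hasDerivAt_dot_s12 {n : ℕ} {f g : ℝ → Fin n → ℝ} {f' g' : Fin n → ℝ} {t : ℝ}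
    (hf : HasDerivAt f f' t) (hg : HasDerivAt g g' t) :
    HasDerivAt (fun s => f s ⬝ᵥ g s) (f' ⬝ᵥ g t + f t ⬝ᵥ g') t := by
  simp only [dotProduct, ← Finset.sum_add_distrib]
  rw [hasDerivAt_pi] at hf hg
  exact HasDerivAt.fun_sum fun i _ => (hf i).mul (hg i)

theorem hasDerivAt_mulVec_aux {n k : ℕ} (M : Matrix (Fin k) (Fin n) ℝ)
    {f : ℝ → Fin n → ℝ} {f' : Fin n → ℝ} {t : ℝ}
    (hf : HasDerivAt f f' t) : HasDerivAt (fun s => M *ᵥ f s) (M *ᵥ f') t := by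
  rw [hasDerivAt_pi] at hf ⊢
  intro i
  simp only [mulVec, dotProduct]
  exact HasDerivAt.fun_sum fun j _ => (hf j).const_mul (M i j)

theorem dot_symm_mulVec {n : ℕ} {M : Matrix (Fin n) (Fin n) ℝ} (hM : M.IsSymm)
    (x y : Fin n → ℝ) : x ⬝ᵥ M *ᵥ y = y ⬝ᵥ M *ᵥ x := by
  rw [dotProduct_mulVec, ← mulVec_transpose, hM.eq, dotProduct_comm]

theorem skew_aux (a c e w : Fin 3 → ℝ) :
    c ⬝ᵥ (-(skew a *ᵥ e) + skew c *ᵥ (w + e)) = e ⬝ᵥ skew a *ᵥ c := by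
  simp [skew, mulVec, dotProduct, Fin.sum_univ_three]
  ring

theorem lyap_aux {n : ℕ} {A P Q : Matrix (Fin n) (Fin n) ℝ} (hP : P.IsSymm)
    (h : Aᵀ * P + P * A = -Q) (x : Fin n → ℝ) :
    2 * (x ⬝ᵥ P *ᵥ (A *ᵥ x)) = -(x ⬝ᵥ Q *ᵥ x) := by
  have h1 : x ⬝ᵥ (Aᵀ * P + P * A) *ᵥ x = -(x ⬝ᵥ Q *ᵥ x) := by
    rw [h, neg_mulVec, dotProduct_neg]
  have h2 : x ⬝ᵥ Aᵀ *ᵥ (P *ᵥ x) = x ⬝ᵥ P *ᵥ (A *ᵥ x) := by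
    rw [dotProduct_mulVec, vecMul_transpose, dot_symm_mulVec hP]
  rw [add_mulVec, dotProduct_add, ← mulVec_mulVec, ← mulVec_mulVec, h2] at h1
  linarith

/-- Lyapunov derivative identity for the passive-filter error
dynamics: along solutions of `Xᵢ' = Aᵢ Xᵢ + Bᵢ b̃ᵢ`,
`b̃ᵢ' = −S(bᵢ)η̃ + S(b̃ᵢ)(ω + η̃) − BᵢᵀPᵢXᵢ`, `η̃' = −Γ ∑ S(bᵢ) b̃ᵢ`, with
`AᵢᵀPᵢ + PᵢAᵢ = −Qᵢ`, the function
`V₂ = ∑ XᵢᵀPᵢXᵢ + ∑ ‖b̃ᵢ‖² + η̃ᵀΓ⁻¹η̃` satisfies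
`V₂' = −∑ XᵢᵀQᵢXᵢ ≤ 0`. -/
theorem stmt12 (m N : ℕ) (hm : 1 ≤ m) (hN : 1 ≤ N)
    (A : Fin m → Matrix (Fin N) (Fin N) ℝ)
    (B : Fin m → Matrix (Fin N) (Fin 3) ℝ)
    (P Q : Fin m → Matrix (Fin N) (Fin N) ℝ)
    (hP : ∀ i, (P i).IsSymm) (hQ : ∀ i, (Q i).PosSemidef)
    (hLyap : ∀ i, (A i)ᵀ * P i + P i * A i = -(Q i))
    (Γ : Matrix (Fin 3) (Fin 3) ℝ) (hΓ : Γ.PosDef) (hΓs : Γ.IsSymm)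
    (ω : ℝ → Fin 3 → ℝ) (b : Fin m → ℝ → Fin 3 → ℝ)
    (X : Fin m → ℝ → Fin N → ℝ) (btil : Fin m → ℝ → Fin 3 → ℝ)
    (η : ℝ → Fin 3 → ℝ)
    (hX : ∀ i t, HasDerivAt (X i)
      ((A i).mulVec (X i t) + (B i).mulVec (btil i t)) t)
    (hbtil : ∀ i t, HasDerivAt (btil i)
      (-(skew (b i t)).mulVec (η t) +
        (skew (btil i t)).mulVec (ω t + η t) -
        (B i)ᵀ.mulVec ((P i).mulVec (X i t))) t)
    (hη : ∀ t, HasDerivAt η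
      (-(Γ.mulVec (∑ i, (skew (b i t)).mulVec (btil i t)))) t) :
    ∀ t, HasDerivAt
        (fun s => ∑ i, X i s ⬝ᵥ (P i).mulVec (X i s) +
          ∑ i, btil i s ⬝ᵥ btil i s + η s ⬝ᵥ Γ⁻¹.mulVec (η s))
        (-∑ i, X i t ⬝ᵥ (Q i).mulVec (X i t)) t ∧
      -∑ i, X i t ⬝ᵥ (Q i).mulVec (X i t) ≤ 0 := by
  intro t
  constructor
  · have hd := ((HasDerivAt.fun_sum (u := Finset.univ) fun i _ =>
        hasDerivAt_dot_s12 (hX i t) (hasDerivAt_mulVec_aux (P i) (hX i t))).add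
      (HasDerivAt.fun_sum (u := Finset.univ) fun i _ =>
        hasDerivAt_dot_s12 (hbtil i t) (hbtil i t))).add
      (hasDerivAt_dot_s12 (hη t) (hasDerivAt_mulVec_aux Γ⁻¹ (hη t)))
    refine hd.congr_deriv ?_
    have hdet : IsUnit Γ.det := (Matrix.isUnit_iff_isUnit_det _).1 hΓ.isUnit
    have hΓi : (Γ⁻¹).IsSymm := by
      unfold Matrix.IsSymm
      rw [transpose_nonsing_inv, hΓs.eq]
    have e3 : ∀ v : Fin 3 → ℝ, -(Γ *ᵥ v) ⬝ᵥ Γ⁻¹ *ᵥ η t + η t ⬝ᵥ Γ⁻¹ *ᵥ (-(Γ *ᵥ v))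
        = -2 * (η t ⬝ᵥ v) := by
      intro v
      rw [dot_symm_mulVec hΓi, mulVec_neg, mulVec_mulVec, nonsing_inv_mul _ hdet, one_mulVec,
        dotProduct_neg]
      ring
    rw [e3, dotProduct_sum, Finset.mul_sum, ← Finset.sum_add_distrib, ← Finset.sum_add_distrib,
      ← Finset.sum_neg_distrib]
    refine Finset.sum_congr rfl fun i _ => ?_
    rw [dot_symm_mulVec (hP i) (A i *ᵥ X i t + B i *ᵥ btil i t) (X i t),
      dotProduct_comm _ (btil i t), dotProduct_sub, skew_aux, mulVec_add, dotProduct_add,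
      ← lyap_aux (hP i) (hLyap i)]
    have h4 : btil i t ⬝ᵥ (B i)ᵀ *ᵥ (P i *ᵥ X i t) = X i t ⬝ᵥ P i *ᵥ (B i *ᵥ btil i t) := by
      rw [dotProduct_mulVec, vecMul_transpose, dot_symm_mulVec (hP i)]
    rw [h4]
    ring
  · rw [neg_nonpos]
    refine Finset.sum_nonneg fun i _ => ?_
    simpa using (hQ i).dotProduct_mulVec_nonneg (X i t)
end

section
/- (Theorem 1, item 1: equilibria.) Let m ≥ 2, let r₁,…,rₘ ∈ ℝ³ with at least two linearly independent, let αᵢ, δᵢ, ρᵢ > 0 (i = 1,…,m) and k > 0, and set W = −Σᵢ ρᵢ S(rᵢ)². A point (b̄₁,…,b̄ₘ, (q̄₀, q̄), ω̄) ∈ ℝ^{3m} × S³ × ℝ³ (so q̄₀² + ‖q̄‖² = 1) is an equilibrium of the closed-loop tracking-error system, i.e. −αᵢ b̄ᵢ − δᵢ S(rᵢ)ω̄ = 0 for all i, −½ q̄ᵀω̄ = 0, ½(q̄₀ I₃ + S(q̄))ω̄ = 0, and −2(q̄₀ I₃ − S(q̄))Wq̄ − Σᵢ ρᵢ S(rᵢ)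 b̄ᵢ − k ω̄ = 0, if and only if b̄ᵢ = 0 for all i, ω̄ = 0, and either (q̄ = 0 and q̄₀ = ±1) or (q̄₀ = 0 and q̄ is a unit eigenvector of W). -/
open Matrix

theorem skew_mulVec (x y : Fin 3 → ℝ) : (skew x).mulVec y =
    ![x 1 * y 2 - x 2 * y 1, x 2 * y 0 - x 0 * y 2, x 0 * y 1 - x 1 * y 0] := by
  ext i
  fin_cases i <;> simp [skew, Matrix.mulVec, dotProduct, Fin.sum_univ_three] <;> ring

theorem dot_skew_sq (x q : Fin 3 → ℝ) : q ⬝ᵥ ((skew x * skew x).mulVec q) =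
    -((skew x).mulVec q ⬝ᵥ (skew x).mulVec q) := by
  rw [← Matrix.mulVec_mulVec]
  simp [skew_mulVec, dotProduct, Fin.sum_univ_three]
  ring

theorem parallel_of_skew (x q : Fin 3 → ℝ) (h : (skew x).mulVec q = 0) :
    (q ⬝ᵥ q) • x = (q ⬝ᵥ x) • q := by
  rw [skew_mulVec] at h
  have h0 := congrFun h 0
  have h1 := congrFun h 1
  have h2 := congrFun h 2
  simp at h0 h1 h2
  ext i
  fin_cases i <;> simp [dotProduct, Fin.sum_univ_three]
  · linear_combination (-q 2) * h1 + q 1 * h2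
  · linear_combination (q 2) * h0 - q 0 * h2
  · linear_combination (-q 1) * h0 + q 0 * h1

theorem not_both (x y q : Fin 3 → ℝ) (hl : LinearIndependent ℝ ![x, y]) (hq : q ≠ 0)
    (hx : (skew x).mulVec q = 0) (hy : (skew y).mulVec q = 0) : False := by
  have hx := parallel_of_skew x q hx
  have hy := parallel_of_skew y q hy
  have hqq : q ⬝ᵥ q ≠ 0 := fun h => hq (dotProduct_self_eq_zero.1 h)
  rw [LinearIndependent.pair_iff] at hl
  have h1 := hl ((q ⬝ᵥ y) * (q ⬝ᵥ q)) (-((q ⬝ᵥ x) * (q ⬝ᵥ q))) (by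
    rw [neg_smul, mul_smul, mul_smul, hx, hy, smul_comm, add_neg_cancel])
  have h2 : q ⬝ᵥ x = 0 := by
    have := h1.2
    simpa [hqq] using this
  rw [h2, zero_smul] at hx
  have := hl (q ⬝ᵥ q) 0 (by rw [hx]; simp)
  exact hqq this.1

theorem W_pos (m : ℕ) (r : Fin m → Fin 3 → ℝ)
    (hr : ∃ i j : Fin m, i ≠ j ∧ LinearIndependent ℝ ![r i, r j])
    (ρ : Fin m → ℝ) (hρ : ∀ i, 0 < ρ i) (q : Fin 3 → ℝ)
    (h : q ⬝ᵥ (-(∑ i, ρ i • (skew (r i) * skew (r i)))).mulVec q = 0) : q = 0 := by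
  by_contra hq
  rw [Matrix.neg_mulVec, Matrix.sum_mulVec, dotProduct_neg, dotProduct_sum,
    ← Finset.sum_neg_distrib] at h
  have hn : ∀ v : Fin 3 → ℝ, 0 ≤ v ⬝ᵥ v := fun v =>
    Finset.sum_nonneg fun i _ => mul_self_nonneg _
  have e : ∀ i, -(q ⬝ᵥ (ρ i • (skew (r i) * skew (r i))).mulVec q) =
      ρ i * ((skew (r i)).mulVec q ⬝ᵥ (skew (r i)).mulVec q) := by
    intro i
    rw [Matrix.smul_mulVec, dotProduct_smul, dot_skew_sq]
    simp
  simp only [e] at h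
  rw [Finset.sum_eq_zero_iff_of_nonneg fun i _ => mul_nonneg (hρ i).le (hn _)] at h
  have hz : ∀ i, (skew (r i)).mulVec q = 0 := by
    intro i
    have := h i (Finset.mem_univ i)
    exact dotProduct_self_eq_zero.1 ((mul_eq_zero.1 this).resolve_left (hρ i).ne')
  obtain ⟨i, j, -, hl⟩ := hr
  exact not_both _ _ q hl hq (hz i) (hz j)

theorem omega_zero (q0 : ℝ) (q w : Fin 3 → ℝ) (hS3 : q0 ^ 2 + q ⬝ᵥ q = 1)
    (h1 : q ⬝ᵥ w = 0)
    (h2 : (q0 • (1 : Matrix (Fin 3) (Fin 3) ℝ) + skew q).mulVec w = 0) : w = 0 := by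
  rw [Matrix.add_mulVec, Matrix.smul_mulVec, Matrix.one_mulVec, skew_mulVec] at h2
  have a0 := congrFun h2 0
  have a1 := congrFun h2 1
  have a2 := congrFun h2 2
  simp at a0 a1 a2
  simp only [dotProduct, Fin.sum_univ_three] at hS3 h1
  ext i
  fin_cases i <;> simp
  · linear_combination q0 * a0 - (q 1 * a2 - q 2 * a1) + q 0 * h1 - w 0 * hS3
  · linear_combination q0 * a1 - (q 2 * a0 - q 0 * a2) + q 1 * h1 - w 1 * hS3
  · linear_combination q0 * a2 - (q 0 * a1 - q 1 * a0) + q 2 * h1 - w 2 * hS3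

theorem skew_anti (x y : Fin 3 → ℝ) : (skew x).mulVec y = -(skew y).mulVec x := by
  rw [skew_mulVec, skew_mulVec]
  ext i
  fin_cases i <;> simp <;> ring

theorem skew_dot (x y : Fin 3 → ℝ) : x ⬝ᵥ (skew x).mulVec y = 0 := by
  rw [skew_mulVec]
  simp [dotProduct, Fin.sum_univ_three]
  ring

/-- Theorem 1, item 1: a point `(b̄₁,…,b̄ₘ,(q̄₀,q̄),ω̄)` on
`ℝ^{3m} × S³ × ℝ³` is an equilibrium of the closed-loop tracking-error system
iff all `b̄ᵢ = 0`, `ω̄ = 0`, and either `q̄ = 0, q̄₀ = ±1` or `q̄₀ = 0` and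
`q̄` is a (unit) eigenvector of `W = −∑ ρᵢ S(rᵢ)²`. -/
theorem stmt14 (m : ℕ) (hm : 2 ≤ m) (r : Fin m → Fin 3 → ℝ)
    (hr : ∃ i j : Fin m, i ≠ j ∧ LinearIndependent ℝ ![r i, r j])
    (α δ ρ : Fin m → ℝ) (hα : ∀ i, 0 < α i) (hδ : ∀ i, 0 < δ i)
    (hρ : ∀ i, 0 < ρ i) (k : ℝ) (hk : 0 < k)
    (W : Matrix (Fin 3) (Fin 3) ℝ)
    (hW : W = -(∑ i, ρ i • (skew (r i) * skew (r i))))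
    (bbar : Fin m → Fin 3 → ℝ) (q0 : ℝ) (q : Fin 3 → ℝ) (ωbar : Fin 3 → ℝ)
    (hS3 : q0 ^ 2 + q ⬝ᵥ q = 1) :
    ((∀ i, -(α i) • bbar i - (δ i) • (skew (r i)).mulVec ωbar = 0) ∧
      -(1 / 2) * (q ⬝ᵥ ωbar) = 0 ∧
      (1 / 2 : ℝ) • ((q0 • (1 : Matrix (Fin 3) (Fin 3) ℝ) +
        skew q).mulVec ωbar) = 0 ∧
      -((2 : ℝ) • ((q0 • (1 : Matrix (Fin 3) (Fin 3) ℝ) -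
          skew q).mulVec (W.mulVec q))) -
        (∑ i, ρ i • (skew (r i)).mulVec (bbar i)) - k • ωbar = 0) ↔
    ((∀ i, bbar i = 0) ∧ ωbar = 0 ∧
      ((q = 0 ∧ (q0 = 1 ∨ q0 = -1)) ∨
        (q0 = 0 ∧ ∃ lam : ℝ, W.mulVec q = lam • q))) := by
  constructor
  · rintro ⟨hb, h1, h2, h3⟩
    have hw : ωbar = 0 := by
      refine omega_zero q0 q ωbar hS3 (by linarith) ?_
      exact (smul_eq_zero.1 h2).resolve_left (by norm_num)
    subst hw
    have hb0 : ∀ i, bbar i = 0 := by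
      intro i
      have := hb i
      rw [Matrix.mulVec_zero, smul_zero, sub_zero] at this
      exact (smul_eq_zero.1 this).resolve_left (neg_ne_zero.2 (hα i).ne')
    refine ⟨hb0, rfl, ?_⟩
    simp only [hb0, Matrix.mulVec_zero, smul_zero, Finset.sum_const_zero, sub_zero] at h3
    have h4 := (smul_eq_zero.1 (neg_eq_zero.1 h3)).resolve_left (by norm_num)
    rw [Matrix.sub_mulVec, Matrix.smul_mulVec, Matrix.one_mulVec] at h4
    have h5 := congrArg (fun v => q ⬝ᵥ v) h4
    simp only [dotProduct_sub, dotProduct_smul, skew_dot, dotProduct_zero, sub_zero,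
      smul_eq_mul] at h5
    rcases mul_eq_zero.1 h5 with h0 | h0
    · right
      refine ⟨h0, q ⬝ᵥ W.mulVec q, ?_⟩
      rw [h0, zero_smul, zero_sub, neg_eq_zero] at h4
      have h6 := parallel_of_skew (W.mulVec q) q (by rw [skew_anti, h4, neg_zero])
      have h7 : q ⬝ᵥ q = 1 := by rw [h0] at hS3; linarith
      rwa [h7, one_smul] at h6
    · left
      subst hW
      have hq := W_pos m r hr ρ hρ q h0
      refine ⟨hq, ?_⟩
      rw [hq, dotProduct_zero, add_zero] at hS3
      simpa using hS3
  · rintro ⟨hb, rfl, h⟩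
    refine ⟨fun i => by simp [hb], by simp, by simp, ?_⟩
    simp only [hb, Matrix.mulVec_zero, smul_zero, Finset.sum_const_zero, sub_zero]
    rcases h with ⟨rfl, -⟩ | ⟨rfl, lam, hl⟩
    · simp
    · have : (skew q).mulVec q = 0 := by
        rw [skew_mulVec]
        ext i
        fin_cases i <;> simp <;> ring
      rw [hl, Matrix.mulVec_smul, Matrix.sub_mulVec, this]
      simp
end

section
/- Let m ≥ 1, r₁,…,rₘ ∈ ℝ³, αᵢ, δᵢ, ρᵢ > 0, k > 0, and W = −Σᵢ ρᵢ S(rᵢ)². Suppose b̄ᵢ : ℝ → ℝ³, q̄₀ : ℝ → ℝ, q̄ : ℝ → ℝ³, ω̄ : ℝ → ℝ³ are differentiable and satisfy the closed-loop tracking-error system: b̄ᵢ' = −αᵢ b̄ᵢ − δᵢ S(rᵢ)ω̄ for each i, q̄₀' = −½ q̄ᵀω̄, q̄' = ½(q̄₀ I₃ + S(q̄))ω̄, and ω̄' = −2(q̄₀ I₃ − S(q̄))Wq̄ − Σᵢ ρᵢ S(rᵢ) b̄ᵢ − k ω̄. Then the function V₃(t) = Σᵢ (ρᵢ/δᵢ)‖b̄ᵢ(t)‖²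 + 4 q̄(t)ᵀ W q̄(t) + ‖ω̄(t)‖² is differentiable and satisfies V₃'(t) = −2k‖ω̄(t)‖² − 2 Σᵢ αᵢ (ρᵢ/δᵢ)‖b̄ᵢ(t)‖² ≤ 0 for all t. -/
open Matrix

theorem hasDerivAt_dot_s15 {u v : ℝ → Fin 3 → ℝ} {u' v' : Fin 3 → ℝ} {t : ℝ}
    (hu : HasDerivAt u u' t) (hv : HasDerivAt v v' t) :
    HasDerivAt (fun s => u s ⬝ᵥ v s) (u' ⬝ᵥ v t + u t ⬝ᵥ v') t := by
  rw [hasDerivAt_pi] at hu hv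
  have h := HasDerivAt.fun_sum (u := Finset.univ) (fun i _ => (hu i).mul (hv i))
  simp only [dotProduct, ← Finset.sum_add_distrib]
  exact h

theorem hasDerivAt_mulVec_const (A : Matrix (Fin 3) (Fin 3) ℝ) {v : ℝ → Fin 3 → ℝ}
    {v' : Fin 3 → ℝ} {t : ℝ} (hv : HasDerivAt v v' t) :
    HasDerivAt (fun s => A.mulVec (v s)) (A.mulVec v') t := by
  rw [hasDerivAt_pi] at hv ⊢
  intro j
  exact HasDerivAt.fun_sum (u := Finset.univ) (fun i _ => (hv i).const_mul (A j i))

theorem skew_transpose (x : Fin 3 → ℝ) : (skew x)ᵀ = -skew x := by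
  ext i j
  fin_cases i <;> fin_cases j <;> simp [skew]

theorem dot_skew (x u v : Fin 3 → ℝ) :
    u ⬝ᵥ (skew x).mulVec v = -(v ⬝ᵥ (skew x).mulVec u) := by
  simp [skew, dotProduct, mulVec, Fin.sum_univ_three]
  ring

theorem dot_symm {A : Matrix (Fin 3) (Fin 3) ℝ} (hA : Aᵀ = A) (u v : Fin 3 → ℝ) :
    u ⬝ᵥ A.mulVec v = v ⬝ᵥ A.mulVec u := by
  rw [dotProduct_mulVec, ← mulVec_transpose, hA, dotProduct_comm]

/-- along solutions of the closed-loop tracking-error system,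
the function `V₃ = ∑ (ρᵢ/δᵢ)‖b̄ᵢ‖² + 4 q̄ᵀWq̄ + ‖ω̄‖²` satisfies
`V₃' = −2k‖ω̄‖² − 2∑ αᵢ(ρᵢ/δᵢ)‖b̄ᵢ‖² ≤ 0`. -/
theorem stmt15 (m : ℕ) (hm : 1 ≤ m) (r : Fin m → Fin 3 → ℝ)
    (α δ ρ : Fin m → ℝ) (hα : ∀ i, 0 < α i) (hδ : ∀ i, 0 < δ i)
    (hρ : ∀ i, 0 < ρ i) (k : ℝ) (hk : 0 < k)
    (W : Matrix (Fin 3) (Fin 3) ℝ)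
    (hW : W = -(∑ i, ρ i • (skew (r i) * skew (r i))))
    (bbar : Fin m → ℝ → Fin 3 → ℝ) (q0 : ℝ → ℝ) (q : ℝ → Fin 3 → ℝ)
    (ωbar : ℝ → Fin 3 → ℝ)
    (hbbar : ∀ i t, HasDerivAt (bbar i)
      (-(α i) • bbar i t - (δ i) • (skew (r i)).mulVec (ωbar t)) t)
    (hq0 : ∀ t, HasDerivAt q0 (-(1 / 2) * (q t ⬝ᵥ ωbar t)) t)
    (hq : ∀ t, HasDerivAt q
      ((1 / 2 : ℝ) • ((q0 t • (1 : Matrix (Fin 3) (Fin 3) ℝ) +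
        skew (q t)).mulVec (ωbar t))) t)
    (hωbar : ∀ t, HasDerivAt ωbar
      (-((2 : ℝ) • ((q0 t • (1 : Matrix (Fin 3) (Fin 3) ℝ) -
          skew (q t)).mulVec (W.mulVec (q t)))) -
        (∑ i, ρ i • (skew (r i)).mulVec (bbar i t)) - k • ωbar t) t) :
    ∀ t, HasDerivAt
        (fun s => ∑ i, (ρ i / δ i) * (bbar i s ⬝ᵥ bbar i s) +
          4 * (q s ⬝ᵥ W.mulVec (q s)) + ωbar s ⬝ᵥ ωbar s)
        (-2 * k * (ωbar t ⬝ᵥ ωbar t) -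
          2 * ∑ i, α i * (ρ i / δ i) * (bbar i t ⬝ᵥ bbar i t)) t ∧
      -2 * k * (ωbar t ⬝ᵥ ωbar t) -
        2 * ∑ i, α i * (ρ i / δ i) * (bbar i t ⬝ᵥ bbar i t) ≤ 0 := by
  intro t
  have hWs : Wᵀ = W := by
    rw [hW]
    simp [transpose_sum, skew_transpose]
  constructor
  · have h1 := HasDerivAt.fun_sum (u := Finset.univ) (fun i _ =>
      (hasDerivAt_dot_s15 (hbbar i t) (hbbar i t)).const_mul (ρ i / δ i))
    have h2 := (hasDerivAt_dot_s15 (hq t) (hasDerivAt_mulVec_const W (hq t))).const_mul 4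
    have h3 := hasDerivAt_dot_s15 (hωbar t) (hωbar t)
    refine ((h1.add h2).add h3).congr_deriv ?_
    have e1 : ∀ i, ρ i / δ i *
        ((-(α i) • bbar i t - (δ i) • (skew (r i)).mulVec (ωbar t)) ⬝ᵥ bbar i t +
         bbar i t ⬝ᵥ (-(α i) • bbar i t - (δ i) • (skew (r i)).mulVec (ωbar t)))
        = -2 * (α i * (ρ i / δ i) * (bbar i t ⬝ᵥ bbar i t))
          + 2 * (ρ i * (ωbar t ⬝ᵥ (skew (r i)).mulVec (bbar i t))) := by
      intro i
      have := (hδ i).ne'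
      rw [dotProduct_comm (-(α i) • bbar i t - (δ i) • (skew (r i)).mulVec (ωbar t))]
      simp only [dotProduct_sub, dotProduct_smul, smul_eq_mul]
      rw [dot_skew (r i) (bbar i t) (ωbar t)]
      field_simp
      ring
    rw [Finset.sum_congr rfl (fun i _ => e1 i), Finset.sum_add_distrib,
      ← Finset.mul_sum, ← Finset.mul_sum]
    rw [dot_symm hWs (q t)]
    rw [dotProduct_comm _ (ωbar t)]
    simp only [dotProduct_sub, dotProduct_neg, dotProduct_sum, dotProduct_smul, smul_dotProduct,
      smul_eq_mul, add_mulVec, sub_mulVec, smul_mulVec, one_mulVec, add_dotProduct]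
    rw [dot_skew (q t) (ωbar t), dotProduct_comm (W.mulVec (q t))]
    ring
  · have hb : 0 ≤ ∑ i, α i * (ρ i / δ i) * (bbar i t ⬝ᵥ bbar i t) :=
      Finset.sum_nonneg fun i _ => mul_nonneg
        (mul_pos (hα i) (div_pos (hρ i) (hδ i))).le
        (Finset.sum_nonneg fun j _ => mul_self_nonneg _)
    have hw : 0 ≤ ωbar t ⬝ᵥ ωbar t := Finset.sum_nonneg fun j _ => mul_self_nonneg _
    nlinarith [mul_nonneg hk.le hw]
end

section
/- (Instability mechanism for the saddle equilibria, Theorem 1, item 3.) Let W ∈ ℝ^{3×3} be symmetric positive definite, let v ∈ ℝ³ be a unit eigenvector of W with eigenvalue λ, and suppose W has another eigenvalue μ < λ with unit eigenvector u orthogonal to v. For Θ = (b̄₁,…,b̄ₘ, (q̄₀,q̄), ω̄) define V₃(Θ) = Σᵢ (ρᵢ/δᵢ)‖b̄ᵢ‖² + 4 q̄ᵀWq̄ + ‖ω̄‖² (with fixed ρᵢ, δᵢ > 0), and let Θ_v = (0,…,0,(0,v),0). Then for every ε ∈ (0,1], the point Θ* = (0,…,0,(0, √(1−ε²) v + ε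 u), 0) lies in ℝ^{3m} × S³ × ℝ³, satisfies ‖√(1−ε²) v + ε u − v‖ ≤ 2ε, and V₃(Θ*) = 4((1−ε²)λ + ε²μ) < 4λ = V₃(Θ_v). In particular, Θ_v is not a local minimum of V₃ restricted to ℝ^{3m} × S³ × ℝ³: every neighborhood of Θ_v contains points with strictly smaller V₃-value. -/
open Matrix

/-- instability mechanism for the saddle equilibria: if `v` is
a unit eigenvector of the symmetric positive definite `W` with eigenvalue
`λ`, and `u ⟂ v` is a unit eigenvector with eigenvalue `μ < λ`, then for
every `ε ∈ (0,1]` the point `Θ* = (0,…,0,(0, √(1−ε²) v + ε u), 0)` lies on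
`ℝ^{3m} × S³ × ℝ³`, is within `2ε` of `Θ_v = (0,…,0,(0,v),0)`, and satisfies
`V₃(Θ*) = 4((1−ε²)λ + ε²μ) < 4λ = V₃(Θ_v)`; in particular every neighborhood
of `Θ_v` contains points of strictly smaller `V₃`-value, so `Θ_v` is not a
local minimum of `V₃`. -/
theorem stmt17 (m : ℕ) (ρ δ : Fin m → ℝ) (hρ : ∀ i, 0 < ρ i)
    (hδ : ∀ i, 0 < δ i)
    (W : Matrix (Fin 3) (Fin 3) ℝ) (hW : W.PosDef)
    (v u : Fin 3 → ℝ) (lam mu : ℝ)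
    (hv : W.mulVec v = lam • v) (hvn : v ⬝ᵥ v = 1)
    (hu : W.mulVec u = mu • u) (hun : u ⬝ᵥ u = 1)
    (huv : u ⬝ᵥ v = 0) (hmu : mu < lam)
    (V3 : (Fin m → Fin 3 → ℝ) → ℝ → (Fin 3 → ℝ) → (Fin 3 → ℝ) → ℝ)
    (hV3 : ∀ bbar q0 q ωbar, V3 bbar q0 q ωbar =
      ∑ i, (ρ i / δ i) * (bbar i ⬝ᵥ bbar i) + 4 * (q ⬝ᵥ W.mulVec q) +
        ωbar ⬝ᵥ ωbar)
    (ε : ℝ) (hε : 0 < ε) (hε1 : ε ≤ 1) :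
    ∀ qstar : Fin 3 → ℝ, qstar = Real.sqrt (1 - ε ^ 2) • v + ε • u →
      (qstar ⬝ᵥ qstar = 1 ∧
        Real.sqrt ((qstar - v) ⬝ᵥ (qstar - v)) ≤ 2 * ε ∧
        V3 0 0 qstar 0 = 4 * ((1 - ε ^ 2) * lam + ε ^ 2 * mu) ∧
        4 * ((1 - ε ^ 2) * lam + ε ^ 2 * mu) < 4 * lam ∧
        V3 0 0 v 0 = 4 * lam) ∧
      ∀ η > (0 : ℝ), ∃ q' : Fin 3 → ℝ, q' ⬝ᵥ q' = 1 ∧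
        Real.sqrt ((q' - v) ⬝ᵥ (q' - v)) < η ∧ V3 0 0 q' 0 < V3 0 0 v 0 := by
  have hvu : v ⬝ᵥ u = 0 := by rw [dotProduct_comm]; exact huv
  have key : ∀ e : ℝ, 0 < e → e ≤ 1 → ∀ q : Fin 3 → ℝ,
      q = Real.sqrt (1 - e ^ 2) • v + e • u →
      (q ⬝ᵥ q = 1 ∧
        Real.sqrt ((q - v) ⬝ᵥ (q - v)) ≤ 2 * e ∧
        V3 0 0 q 0 = 4 * ((1 - e ^ 2) * lam + e ^ 2 * mu) ∧
        4 * ((1 - e ^ 2) * lam + e ^ 2 * mu) < 4 * lam ∧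
        V3 0 0 v 0 = 4 * lam) := by
    intro e he he1 q hq
    have hnn : 0 ≤ 1 - e ^ 2 := by nlinarith
    have hs2 := Real.sq_sqrt hnn
    have hs0 := Real.sqrt_nonneg (1 - e ^ 2)
    generalize Real.sqrt (1 - e ^ 2) = s at *
    have hs1 : s ≤ 1 := by nlinarith [sq_nonneg e]
    subst hq
    refine ⟨?_, ?_, ?_, ?_, ?_⟩
    · simp only [add_dotProduct, dotProduct_add, smul_dotProduct, dotProduct_smul,
        smul_eq_mul, hvn, hun, huv, hvu]
      linarith
    · apply Real.sqrt_le_iff.mpr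
      refine ⟨by linarith, ?_⟩
      simp only [sub_dotProduct, dotProduct_sub, add_dotProduct, dotProduct_add,
        smul_dotProduct, dotProduct_smul, smul_eq_mul, hvn, hun, huv, hvu]
      nlinarith [mul_nonneg hs0 (sub_nonneg.mpr hs1), sq_nonneg e]
    · rw [hV3]
      simp only [Matrix.mulVec_add, Matrix.mulVec_smul, hv, hu, add_dotProduct,
        dotProduct_add, smul_dotProduct, dotProduct_smul, smul_eq_mul, hvn, hun, huv, hvu,
        Pi.zero_apply, dotProduct_zero, mul_zero, Finset.sum_const_zero]
      rw [← hs2]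
      ring
    · nlinarith [mul_pos (pow_pos he 2) (sub_pos.mpr hmu)]
    · rw [hV3]
      simp [hv, hvn]
  intro qstar hq
  refine ⟨key ε hε hε1 qstar hq, ?_⟩
  intro η hη
  have he : 0 < min 1 (η / 4) := lt_min one_pos (by linarith)
  obtain ⟨h1, h2, h3, h4, h5⟩ := key (min 1 (η / 4)) he (min_le_left _ _) _ rfl
  refine ⟨_, h1, ?_, ?_⟩
  · have := min_le_right 1 (η / 4)
    linarith
  · rw [h3, h5]
    exact h4
end
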